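/- arXiv:2206.10508 — 2 statements merged into one kernel-verified Lean document; each statement's English description precedes it below -/
import Mathlib

section
/- Let (X,T) be a topological dynamical system such that the full shift on {0,1}^ℕ embeds into (X, T^k) for some k ≥ 1 (i.e., (X,T) has a horseshoe). Then the topological mean dimension of the induced system (M(X), T_*) is infinite. -/
open MeasureTheory Filter
open scoped Classical

/-- A finite open cover of `Y`. -/
def IsFinOpenCover {Y : Type*} [TopologicalSpace Y] (α : Finset (Set Y)) : Prop :=
  (∀ U ∈ α, IsOpen U) ∧ ∀ y : Y, ∃ U ∈ α, y ∈ U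

/-- Order of a finite cover: `sup_y (#{U ∈ α | y ∈ U}) − 1`. -/
noncomputable def coverOrd {Y : Type*} [TopologicalSpace Y] (α : Finset (Set Y)) : ℕ :=
  sSup {c : ℕ | ∃ y : Y, (α.filter (fun U => y ∈ U)).card = c} - 1

/-- `β` refines `α`. -/
def Refines {Y : Type*} (β α : Finset (Set Y)) : Prop :=
  ∀ V ∈ β, ∃ U ∈ α, V ⊆ U

/-- `D(α)`: minimal order of a finite open cover refining `α`. -/
noncomputable def coverD {Y : Type*} [TopologicalSpace Y] (α : Finset (Set Y)) : ℕ :=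
  sInf {c : ℕ | ∃ β : Finset (Set Y), IsFinOpenCover β ∧ Refines β α ∧ coverOrd β = c}

/-- The dynamical join `⋁_{i<n} S^{-i} α`. -/
noncomputable def dynJoin {Y : Type*} [TopologicalSpace Y] (S : Y → Y) (n : ℕ)
    (α : Finset (Set Y)) : Finset (Set Y) :=
  Finset.image (fun f : Fin n → Set Y => ⋂ i : Fin n, S^[(i : ℕ)] ⁻¹' f i)
    (Fintype.piFinset fun _ : Fin n => α)

/-- Topological mean dimension `mdim(Y,S) = sup_α lim_n D(⋁_{i<n} S^{-i}α)/n`,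
valued in `ℝ≥0∞`. -/
noncomputable def meanDim {Y : Type*} [TopologicalSpace Y] (S : Y → Y) : ENNReal :=
  ⨆ (α : Finset (Set Y)) (_ : IsFinOpenCover α),
    Filter.limsup (fun n : ℕ => (coverD (dynJoin S n α) : ENNReal) / n) Filter.atTop

namespace Horse

/-- Sum over monotone lattice paths from `x` using each direction of `s` once. -/
noncomputable def pathSum {N : ℕ} (c : (Fin N → ℕ) → ℕ) :
    ℕ → Finset (Fin N) → (Fin N → ℕ) → (Multiset ℕ → ZMod 2) → ZMod 2
  | 0, _, x, g => g {c x}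
  | n + 1, s, x, g => ∑ a ∈ s, pathSum c n (s.erase a) (Function.update x a (x a + 1))
      (fun M => g (c x ::ₘ M))

/-- Coboundary. -/
noncomputable def cob (g : Multiset ℕ → ZMod 2) (M : Multiset ℕ) : ZMod 2 :=
  (M.map (fun b => g (M.erase b))).sum

lemma cob_cons (g : Multiset ℕ → ZMod 2) (b : ℕ) (M : Multiset ℕ) :
    cob g (b ::ₘ M) = g M + cob (fun M => g (b ::ₘ M)) M := by
  unfold cob
  rw [Multiset.map_cons, Multiset.sum_cons, Multiset.erase_cons_head]
  congr 2
  apply Multiset.map_congr rfl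
  intro v hv
  rw [Multiset.erase_cons_tail_of_mem hv]

lemma pathSum_add {N : ℕ} (c : (Fin N → ℕ) → ℕ) (n : ℕ) : ∀ (s : Finset (Fin N)) (x : Fin N → ℕ)
    (g h : Multiset ℕ → ZMod 2),
    pathSum c n s x (fun M => g M + h M) = pathSum c n s x g + pathSum c n s x h := by
  induction n with
  | zero => intro s x g h; rfl
  | succ n ih =>
    intro s x g h
    simp only [pathSum, ih, Finset.sum_add_distrib]

/-- The unit cube at `x` with directions `s`. -/
def inCube {N : ℕ} (s : Finset (Fin N)) (x v : Fin N → ℕ) : Prop :=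
  ∀ i, v i = x i ∨ (i ∈ s ∧ v i = x i + 1)

lemma pathSum_congr {N : ℕ} (c : (Fin N → ℕ) → ℕ) (n : ℕ) :
    ∀ (s : Finset (Fin N)) (x : Fin N → ℕ) (g h : Multiset ℕ → ZMod 2),
    (∀ M : Multiset ℕ, (∀ b ∈ M, ∃ v, inCube s x v ∧ c v = b) → g M = h M) →
    pathSum c n s x g = pathSum c n s x h := by
  induction n with
  | zero =>
    intro s x g h H
    apply H
    intro b hb
    rw [Multiset.mem_singleton] at hb
    exact ⟨x, fun i => Or.inl rfl, hb.symm⟩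
  | succ n ih =>
    intro s x g h H
    simp only [pathSum]
    apply Finset.sum_congr rfl
    intro a ha
    apply ih
    intro M hM
    apply H
    intro b hb
    rcases Multiset.mem_cons.1 hb with rfl | hb
    · exact ⟨x, fun i => Or.inl rfl, rfl⟩
    · obtain ⟨v, hv, hc⟩ := hM b hb
      refine ⟨v, fun i => ?_, hc⟩
      by_cases hi : i = a
      · subst hi
        right
        rcases hv i with h1 | h1
        · exact ⟨ha, by simpa using h1⟩
        · simp at h1
      · rcases hv i with h1 | h1
        · left; simpa [hi] using h1
        · right; simpa [hi] using h1

lemma pathSum_zero {N : ℕ} (c : (Fin N → ℕ) → ℕ) (n : ℕ) :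
    ∀ (s : Finset (Fin N)) (x : Fin N → ℕ), pathSum c n s x (fun _ => 0) = 0 := by
  induction n with
  | zero => intro s x; rfl
  | succ n ih => intro s x; simp [pathSum, ih]

lemma pathSum_cob {N : ℕ} (c : (Fin N → ℕ) → ℕ) (n : ℕ) :
    ∀ (s : Finset (Fin N)) (x : Fin N → ℕ) (g : Multiset ℕ → ZMod 2), s.card = n + 1 →
    pathSum c (n + 1) s x (cob g) =
      ∑ a ∈ s, (pathSum c n (s.erase a) (Function.update x a (x a + 1)) g
        + pathSum c n (s.erase a) x g) := by
  induction n with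
  | zero =>
    intro s x g hs
    simp only [pathSum]
    apply Finset.sum_congr rfl
    intro a ha
    rw [cob_cons]
    simp [cob]
  | succ n ih =>
    intro s x g hs
    rw [pathSum]
    simp only [cob_cons, pathSum_add]
    rw [Finset.sum_add_distrib, Finset.sum_add_distrib]
    congr 1
    have h1 : ∀ a ∈ s, pathSum c (n + 1) (s.erase a) (Function.update x a (x a + 1))
        (cob (fun M => g (c x ::ₘ M))) =
        ∑ b ∈ s.erase a, (pathSum c n ((s.erase a).erase b)
          (Function.update (Function.update x a (x a + 1)) b
            ((Function.update x a (x a + 1)) b + 1)) (fun M => g (c x ::ₘ M))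
        + pathSum c n ((s.erase a).erase b) (Function.update x a (x a + 1))
            (fun M => g (c x ::ₘ M))) := by
      intro a ha
      apply ih
      rw [Finset.card_erase_of_mem ha, hs]; rfl
    rw [Finset.sum_congr rfl h1]
    simp only [Finset.sum_add_distrib]
    have h2 : ∑ a ∈ s, ∑ b ∈ s.erase a, pathSum c n ((s.erase a).erase b)
          (Function.update (Function.update x a (x a + 1)) b
            ((Function.update x a (x a + 1)) b + 1)) (fun M => g (c x ::ₘ M)) = 0 := by
      rw [Finset.sum_sigma']
      refine Finset.sum_involution (fun p _ => ⟨p.2, p.1⟩) ?_ ?_ ?_ ?_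
      · rintro ⟨a, b⟩ hab
        simp only [Finset.mem_sigma, Finset.mem_erase] at hab
        simp only
        rw [Finset.erase_right_comm, Function.update_of_ne hab.2.1,
          Function.update_of_ne hab.2.1.symm, Function.update_comm hab.2.1]
        exact CharTwo.add_self_eq_zero _
      · rintro ⟨a, b⟩ hab _ h
        simp only [Finset.mem_sigma, Finset.mem_erase] at hab
        simp only [Sigma.mk.injEq] at h
        exact hab.2.1 h.1
      · rintro ⟨a, b⟩ hab
        simp only [Finset.mem_sigma, Finset.mem_erase] at hab ⊢
        exact ⟨hab.2.2, hab.2.1.symm, hab.1⟩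
      · rintro ⟨a, b⟩ hab
        rfl
    rw [h2, zero_add]
    simp only [pathSum]
    rw [Finset.sum_sigma', Finset.sum_sigma']
    refine Finset.sum_bij' (fun p _ => ⟨p.2, p.1⟩) (fun p _ => ⟨p.2, p.1⟩) ?_ ?_ ?_ ?_ ?_
    · rintro ⟨a, b⟩ hab
      simp only [Finset.mem_sigma, Finset.mem_erase] at hab ⊢
      exact ⟨hab.2.2, hab.2.1.symm, hab.1⟩
    · rintro ⟨a, b⟩ hab
      simp only [Finset.mem_sigma, Finset.mem_erase] at hab ⊢
      exact ⟨hab.2.2, hab.2.1.symm, hab.1⟩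
    · rintro ⟨a, b⟩ hab
      rfl
    · rintro ⟨a, b⟩ hab
      rfl
    · rintro ⟨a, b⟩ hab
      simp only
      rw [Finset.erase_right_comm]

/-- Indicator of being the full set of colours `0, …, k-1`. -/
noncomputable def full (k : ℕ) (M : Multiset ℕ) : ZMod 2 := if M = Multiset.range k then 1 else 0

lemma cob_full (k : ℕ) (M : Multiset ℕ) (hM : ∀ b ∈ M, b ≤ k) :
    cob (full k) M = full (k + 1) M := by
  by_cases h : ∃ b, M = b ::ₘ Multiset.range k
  · obtain ⟨b, rfl⟩ := h
    rw [cob_cons]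
    have hb := hM b (Multiset.mem_cons_self _ _)
    have h1 : full k (Multiset.range k) = 1 := by simp [full]
    rw [h1]
    have key : ∀ v ∈ Multiset.range k, (full k (b ::ₘ (Multiset.range k).erase v)) =
        if v = b then 1 else 0 := by
      intro v hv
      unfold full
      congr 1
      rw [eq_iff_iff]
      constructor
      · intro h
        rw [← Multiset.cons_erase hv] at h
        rw [Multiset.erase_cons_head] at h
        exact ((Multiset.cons_inj_left _).1 h).symm
      · rintro rfl
        exact Multiset.cons_erase hv
    have h2 : cob (fun M => full k (b ::ₘ M)) (Multiset.range k) = if b < k then 1 else 0 := by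
      unfold cob
      rw [Multiset.map_congr rfl key]
      change ∑ v ∈ Finset.range k, _ = _
      rw [Finset.sum_ite_eq']
      simp
    rw [h2]
    rcases hb.lt_or_eq with hb | rfl
    · rw [if_pos hb]
      have : full (k+1) (b ::ₘ Multiset.range k) = 0 := by
        unfold full
        rw [if_neg]
        rw [Multiset.range_succ, Multiset.cons_inj_left]
        omega
      rw [this]; rfl
    · simp [full, Multiset.range_succ]
  · push Not at h
    have h1 : full (k + 1) M = 0 := by
      unfold full
      rw [if_neg]
      rw [Multiset.range_succ]; exact h k
    rw [h1]
    unfold cob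
    apply Multiset.sum_eq_zero
    intro y hy
    obtain ⟨b, hb, rfl⟩ := Multiset.mem_map.1 hy
    unfold full
    rw [if_neg]
    intro h2
    apply h b
    rw [← h2, Multiset.cons_erase hb]

/-- base points -/
noncomputable def box (N m : ℕ) (s : Finset (Fin N)) : Finset (Fin N → ℕ) :=
  Fintype.piFinset (fun i => if i ∈ s then Finset.range m else {0})

lemma mem_box {N m : ℕ} {s : Finset (Fin N)} {x : Fin N → ℕ} :
    x ∈ box N m s ↔ ∀ i, (i ∈ s → x i < m) ∧ (i ∉ s → x i = 0) := by
  unfold box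
  rw [Fintype.mem_piFinset]
  apply forall_congr'
  intro i
  by_cases h : i ∈ s <;> simp [h]

lemma sum_box {N m : ℕ} {s : Finset (Fin N)} {a : Fin N} (ha : a ∈ s)
    (F : (Fin N → ℕ) → ZMod 2) :
    ∑ x ∈ box N m s, F x = ∑ x ∈ box N m (s.erase a), ∑ t ∈ Finset.range m,
      F (Function.update x a t) := by
  rw [Finset.sum_sigma']
  refine Finset.sum_bij' (fun x _ => ⟨Function.update x a 0, x a⟩)
    (fun p _ => Function.update p.1 a p.2) ?_ ?_ ?_ ?_ ?_
  · intro x hx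
    rw [mem_box] at hx
    simp only [Finset.mem_sigma, Finset.mem_range, mem_box]
    refine ⟨fun i => ?_, (hx a).1 ha⟩
    by_cases hi : i = a
    · subst hi; simp
    · simpa [hi] using hx i
  · rintro ⟨x, t⟩ hx
    simp only [Finset.mem_sigma, Finset.mem_range, mem_box] at hx
    rw [mem_box]
    intro i
    by_cases hi : i = a
    · subst hi; simp [ha, hx.2]
    · simpa [hi] using hx.1 i
  · intro x hx
    simp
  · rintro ⟨x, t⟩ hx
    simp only [Finset.mem_sigma, Finset.mem_range, mem_box] at hx
    have : x a = 0 := (hx.1 a).2 (by simp)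
    simp [← this]
  · intro x hx
    simp

lemma tele (Q : ℕ → ZMod 2) (m : ℕ) :
    ∑ t ∈ Finset.range m, (Q (t + 1) + Q t) = Q m + Q 0 := by
  have := Finset.sum_range_sub Q m
  simpa only [CharTwo.sub_eq_add] using this

lemma boundary {N m : ℕ} (c : (Fin N → ℕ) → ℕ) (n : ℕ) (s : Finset (Fin N)) (hs : s.card = n + 1)
    (g : Multiset ℕ → ZMod 2) :
    ∑ x ∈ box N m s, pathSum c (n + 1) s x (cob g) =
      ∑ a ∈ s, ∑ x ∈ box N m (s.erase a),
        (pathSum c n (s.erase a) (Function.update x a m) g + pathSum c n (s.erase a) x g) := by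
  simp only [pathSum_cob c n s _ g hs]
  rw [Finset.sum_comm]
  apply Finset.sum_congr rfl
  intro a ha
  rw [sum_box ha]
  apply Finset.sum_congr rfl
  intro x hx
  have h0 : x a = 0 := ((mem_box.1 hx) a).2 (by simp)
  have := tele (fun t => pathSum c n (s.erase a) (Function.update x a t) g) m
  simp only [Function.update_self, Function.update_idem]
  rw [this]
  rw [← h0]
  simp

/-- Kuhn's lemma. -/
lemma kuhn {N m : ℕ} (c : (Fin N → ℕ) → ℕ)
    (hN : ∀ x, (∀ i, x i ≤ m) → c x ≤ N)
    (h0 : ∀ x, (∀ i, x i ≤ m) → ∀ i : Fin N, x i = 0 → c x ≤ i)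
    (h1 : ∀ x, (∀ i, x i ≤ m) → ∀ i : Fin N, x i = m → c x ≠ i) :
    ∃ x : Fin N → ℕ, (∀ i, x i < m) ∧ ∀ b ≤ N, ∃ v, inCube Finset.univ x v ∧ c v = b := by
  have key : ∀ k, k ≤ N → ∑ x ∈ box N m (Finset.univ.filter (fun i : Fin N => (i : ℕ) < k)),
      pathSum c k (Finset.univ.filter (fun i : Fin N => (i : ℕ) < k)) x (full (k + 1)) = 1 := by
    intro k
    induction k with
    | zero =>
      intro _
      have hb : box N m (Finset.univ.filter (fun i : Fin N => (i : ℕ) < 0)) = {0} := by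
        ext x
        rw [mem_box]
        simp [funext_iff]
      rw [hb, Finset.sum_singleton]
      have : c 0 = 0 := by
        rcases Nat.eq_zero_or_pos N with h | h
        · have := hN 0 (by simp); omega
        · have := h0 0 (by simp) ⟨0, h⟩ rfl
          simpa using this
      simp [pathSum, this, full]
    | succ k ih =>
      intro hk
      have ih := ih (by omega)
      set s := Finset.univ.filter (fun i : Fin N => (i : ℕ) < k + 1) with hs
      have hscard : s.card = k + 1 := by
        rw [hs, Fin.card_filter_val_lt]; omega
      have e1 : ∑ x ∈ box N m s, pathSum c (k + 1) s x (full (k + 1 + 1)) =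
          ∑ x ∈ box N m s, pathSum c (k + 1) s x (cob (full (k + 1))) := by
        apply Finset.sum_congr rfl
        intro x hx
        rw [mem_box] at hx
        apply pathSum_congr
        intro M hM
        rw [cob_full]
        intro b hb
        obtain ⟨v, hv, rfl⟩ := hM b hb
        have hvm : ∀ i, v i ≤ m := by
          intro i
          by_cases hi : i ∈ s
          · have := (hx i).1 hi
            rcases hv i with h | h <;> omega
          · have := (hx i).2 hi
            rcases hv i with h | h
            · omega
            · exact absurd h.1 hi
        rcases hk.lt_or_eq with hk | hk
        · refine h0 v hvm ⟨k + 1, hk⟩ ?_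
          have hi : (⟨k + 1, hk⟩ : Fin N) ∉ s := by simp [hs]
          rcases hv ⟨k + 1, hk⟩ with h | h
          · rw [h, (hx _).2 hi]
          · exact absurd h.1 hi
        · rw [hk]; exact hN v hvm
      rw [e1, boundary c k s hscard]
      have hks : (⟨k, hk⟩ : Fin N) ∈ s := by simp [hs]
      have hse : s.erase ⟨k, hk⟩ = Finset.univ.filter (fun i : Fin N => (i : ℕ) < k) := by
        ext i
        simp only [hs, Finset.mem_erase, Finset.mem_filter, Finset.mem_univ, true_and, ne_eq,
          Fin.ext_iff]
        omega
      -- generic vanishing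
      have hmiss : ∀ (a : Fin N) (j : ℕ), j ≤ k → a ∈ s → ∀ x : Fin N → ℕ, (∀ i, i ∈ s.erase a → x i < m) →
          (∀ i, x i ≤ m) →
          (∀ v, (∀ i, v i ≤ m) → v a = x a → c v ≠ j) →
          pathSum c k (s.erase a) x (full (k + 1)) = 0 := by
        intro a j hj ha x hx hxm hc
        rw [← pathSum_zero c k (s.erase a) x]
        apply pathSum_congr
        intro M hM
        unfold full
        rw [if_neg]
        rintro rfl
        obtain ⟨v, hv, hvj⟩ := hM j (by simp; omega)
        refine hc v ?_ ?_ hvj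
        · intro i
          rcases hv i with h | h
          · rw [h]; exact hxm i
          · have := hx i h.1; omega
        · rcases hv a with h | h
          · exact h
          · simp at h
      rw [Finset.sum_eq_single_of_mem _ hks]
      · rw [Finset.sum_add_distrib, hse, ih]
        rw [Finset.sum_eq_zero, zero_add]
        intro x hx
        rw [← hse] at hx ⊢
        rw [mem_box] at hx
        apply hmiss ⟨k, hk⟩ k le_rfl hks
        · intro i hi
          have := (hx i).1 hi
          rw [Function.update_of_ne (Finset.ne_of_mem_erase hi)]
          exact this
        · intro i
          by_cases hi : i = ⟨k, hk⟩
          · subst hi; simp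
          · rw [Function.update_of_ne hi]
            by_cases h : i ∈ s.erase ⟨k, hk⟩
            · exact ((hx i).1 h).le
            · rw [(hx i).2 h]; omega
        · intro v hv hva
          exact h1 v hv ⟨k, hk⟩ (by simpa using hva)
      · intro a ha hak
        have hak' : (a : ℕ) < k := by
          have h3 : (a : ℕ) < k + 1 := by simpa [hs] using ha
          have h4 : (a : ℕ) ≠ k := fun h => hak (Fin.ext h)
          omega
        apply Finset.sum_eq_zero
        intro x hx
        rw [mem_box] at hx
        have hxm : ∀ i, x i ≤ m := by
          intro i
          by_cases h : i ∈ s.erase a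
          · exact ((hx i).1 h).le
          · rw [(hx i).2 h]; omega
        rw [hmiss a a hak'.le ha, hmiss a k le_rfl ha, add_zero]
        · exact fun i hi => (hx i).1 hi
        · exact hxm
        · intro v hv hva
          have : x a = 0 := (hx a).2 (by simp)
          have := h0 v hv a (by rw [hva, this])
          omega
        · intro i hi
          rw [Function.update_of_ne (Finset.ne_of_mem_erase hi)]
          exact (hx i).1 hi
        · intro i
          by_cases hi : i = a
          · subst hi; simp
          · rw [Function.update_of_ne hi]; exact hxm i
        · intro v hv hva
          exact h1 v hv a (by simpa using hva)
  have hN' := key N le_rfl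
  have hu : Finset.univ.filter (fun i : Fin N => (i : ℕ) < N) = Finset.univ := by
    ext i; simp
  rw [hu] at hN'
  have : ∃ x ∈ box N m Finset.univ, pathSum c N Finset.univ x (full (N + 1)) ≠ 0 := by
    apply Finset.exists_ne_zero_of_sum_ne_zero
    rw [hN']; exact one_ne_zero
  obtain ⟨x, hx, hne⟩ := this
  rw [mem_box] at hx
  refine ⟨x, fun i => (hx i).1 (by simp), ?_⟩
  by_contra hcon
  push Not at hcon
  obtain ⟨b, hb, hcon⟩ := hcon
  apply hne
  rw [← pathSum_zero c N Finset.univ x]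
  apply pathSum_congr
  intro M hM
  unfold full
  rw [if_neg]
  rintro rfl
  obtain ⟨v, hv, hvb⟩ := hM b (by simp; omega)
  exact hcon v hv hvb

/-- Lebesgue covering lemma. -/
lemma lebesgue {N : ℕ} {B : Type*} (β : Finset B) (V : B → Set (Fin N → unitInterval))
    (ho : ∀ U ∈ β, IsOpen (V U)) (hc : ∀ p, ∃ U ∈ β, p ∈ V U)
    (hf : ∀ U ∈ β, ∀ i, (∀ p ∈ V U, p i ≠ 0) ∨ (∀ p ∈ V U, p i ≠ 1)) :
    ∃ p, N + 1 ≤ (β.filter (fun U => p ∈ V U)).card := by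
  obtain ⟨δ, hδ, hleb⟩ := lebesgue_number_lemma_of_metric (s := Set.univ)
    (c := fun U : β => V U) isCompact_univ (fun U => ho U U.2) (by
      intro p _
      obtain ⟨U, hU, hp⟩ := hc p
      exact Set.mem_iUnion.2 ⟨⟨U, hU⟩, hp⟩)
  obtain ⟨m', hm'⟩ := exists_nat_one_div_lt hδ
  set m := m' + 1 with hm
  choose lab hlab using fun p => hleb p (Set.mem_univ p)
  let pt : (Fin N → ℕ) → (Fin N → unitInterval) := fun x i =>
    Set.projIcc 0 1 zero_le_one ((x i : ℝ) / m)
  have hmpos : (0 : ℝ) < m := by rw [hm]; positivity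
  -- colour of a cover element
  let P : B → ℕ → Prop := fun U j => j = N ∨ ∃ i : Fin N, (i : ℕ) = j ∧ ∃ p ∈ V U, p i = 0
  have hP : ∀ U, ∃ j, P U j := fun U => ⟨N, Or.inl rfl⟩
  let col : B → ℕ := fun U => Nat.find (hP U)
  obtain ⟨x, hx, hrain⟩ := kuhn (m := m) (fun x => col (lab (pt x)))
    (fun x _ => Nat.find_min' (hP _) (Or.inl rfl))
    (by
      intro x _ i hi
      refine Nat.find_min' (hP _) (Or.inr ⟨i, rfl, pt x, hlab _ (Metric.mem_ball_self hδ), ?_⟩)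
      simp [pt, hi])
    (by
      intro x _ i hi hcol
      have h1 : P (lab (pt x)) i := hcol ▸ Nat.find_spec (hP (lab (pt x)))
      rcases h1 with h1 | ⟨i', hii, p, hp, hp0⟩
      · have := i.2; omega
      · obtain rfl : i' = i := Fin.ext hii
        rcases hf _ (lab (pt x)).2 i' with h | h
        · exact h p hp hp0
        · refine h (pt x) (hlab _ (Metric.mem_ball_self hδ)) ?_
          simp [pt, hi])
  refine ⟨pt x, ?_⟩
  have hdist : ∀ v, inCube Finset.univ x v → pt x ∈ V (lab (pt v)) := by
    intro v hv
    apply hlab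
    rw [Metric.mem_ball, dist_pi_lt_iff hδ]
    intro i
    refine lt_of_le_of_lt ?_ hm'
    have h2 := LipschitzWith.dist_le_mul (LipschitzWith.projIcc (zero_le_one (α := ℝ)))
      ((x i : ℝ) / m) ((v i : ℝ) / m)
    refine h2.trans ?_
    rw [NNReal.coe_one, one_mul, Real.dist_eq, ← sub_div, abs_div, abs_of_pos hmpos, hm]
    push_cast
    gcongr
    rcases hv i with h | h
    · rw [h]; simp
    · rw [h.2]; simp
  choose! w hw hwc using hrain
  have hinj : Set.InjOn (fun b => (lab (pt (w b)) : B)) (Finset.range (N + 1) : Set ℕ) := by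
    intro a ha b hb hab
    simp only [Finset.coe_range, Set.mem_Iio] at ha hb
    have h3 := hwc a (by omega)
    have h4 := hwc b (by omega)
    simp only at h3 h4 hab
    rw [← h3, ← h4, hab]
  calc N + 1 = (Finset.range (N + 1)).card := by simp
    _ = ((Finset.range (N + 1)).image (fun b => (lab (pt (w b)) : B))).card :=
        (Finset.card_image_of_injOn hinj).symm
    _ ≤ _ := by
      apply Finset.card_le_card
      intro U hU
      obtain ⟨b, hb, rfl⟩ := Finset.mem_image.1 hU
      rw [Finset.mem_range] at hb
      rw [Finset.mem_filter]
      exact ⟨(lab _).2, hdist _ (hw b (by omega))⟩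

lemma lebesgue' {ι : Type*} [Fintype ι] {B : Type*} (β : Finset B)
    (V : B → Set (ι → unitInterval))
    (ho : ∀ U ∈ β, IsOpen (V U)) (hc : ∀ p, ∃ U ∈ β, p ∈ V U)
    (hf : ∀ U ∈ β, ∀ i, (∀ p ∈ V U, p i ≠ 0) ∨ (∀ p ∈ V U, p i ≠ 1)) :
    ∃ p, Fintype.card ι + 1 ≤ (β.filter (fun U => p ∈ V U)).card := by
  let e := Fintype.equivFin ι
  let r : (Fin (Fintype.card ι) → unitInterval) → (ι → unitInterval) := fun p i => p (e i)
  have hr : Continuous r := by fun_prop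
  obtain ⟨p, hp⟩ := lebesgue β (fun U => r ⁻¹' V U) (fun U hU => (ho U hU).preimage hr)
    (fun p => hc (r p)) (by
      intro U hU i
      rcases hf U hU (e.symm i) with h | h
      · left; intro p hp; simpa [r] using h _ hp
      · right; intro p hp; simpa [r] using h _ hp)
  exact ⟨r p, hp⟩

end Horse

namespace Horse

section
variable {X : Type*} [MetricSpace X] [CompactSpace X] [MeasurableSpace X] [BorelSpace X]

/-- The induced map. -/
noncomputable def ind (T : X → X) (hT : Continuous T) (μ : ProbabilityMeasure X) :
    ProbabilityMeasure X := μ.map (f := T) hT.measurable.aemeasurable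

lemma ind_continuous (T : X → X) (hT : Continuous T) : Continuous (ind T hT) :=
  ProbabilityMeasure.continuous_map hT

lemma integral_ind (T : X → X) (hT : Continuous T) (n : ℕ) : ∀ (f : C(X, ℝ))
    (μ : ProbabilityMeasure X),
    ∫ x, f x ∂((ind T hT)^[n] μ : Measure X) = ∫ x, f (T^[n] x) ∂(μ : Measure X) := by
  induction n with
  | zero => intro f μ; rfl
  | succ n ih =>
    intro f μ
    rw [Function.iterate_succ_apply, ih f (ind T hT μ)]
    unfold ind
    rw [ProbabilityMeasure.toMeasure_map, integral_map hT.measurable.aemeasurable]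
    · rfl
    · exact (f.continuous.comp (hT.iterate n)).aestronglyMeasurable

lemma integrable_cont (f : C(X, ℝ)) (μ : Measure X) [IsFiniteMeasure μ] :
    Integrable (fun x => f x) μ := by
  have := (BoundedContinuousFunction.mkOfCompact f).integrable μ
  exact this

/-- Coordinates distribution. -/
noncomputable def prob {W : Type*} [Fintype W] (t : W → unitInterval) : Option W → ℝ
  | none => 1 - ∑ w, (t w : ℝ) / Fintype.card W
  | some w => (t w : ℝ) / Fintype.card W

lemma prob_sum {W : Type*} [Fintype W] (t : W → unitInterval) : ∑ o, prob t o = 1 := by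
  rw [Fintype.sum_option]; simp [prob]

lemma prob_nonneg {W : Type*} [Fintype W] (t : W → unitInterval) (o : Option W) :
    0 ≤ prob t o := by
  cases o with
  | none =>
    simp only [prob]
    have : ∑ w, (t w : ℝ) / Fintype.card W ≤ ∑ w : W, (1 : ℝ) / Fintype.card W := by
      gcongr with w
      exact (t w).2.2
    have h2 : ∑ w : W, (1 : ℝ) / Fintype.card W ≤ 1 := by
      simp only [Finset.sum_const, Finset.card_univ, nsmul_eq_mul]
      rw [mul_one_div]
      exact div_self_le_one _
    linarith
  | some w =>
    simp only [prob]
    have := (t w).2.1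
    positivity

/-- weight of a word -/
noncomputable def wt {W : Type*} [Fintype W] {q : ℕ} (t : Fin q × W → unitInterval)
    (s : Fin q → Option W) : ℝ := ∏ j, prob (fun w => t (j, w)) (s j)

lemma wt_nonneg {W : Type*} [Fintype W] {q : ℕ} (t : Fin q × W → unitInterval)
    (s : Fin q → Option W) : 0 ≤ wt t s := Finset.prod_nonneg fun _ _ => prob_nonneg _ _

lemma wt_sum {W : Type*} [Fintype W] {q : ℕ} (t : Fin q × W → unitInterval) :
    ∑ s, wt t s = 1 := by
  have := Finset.prod_univ_sum (fun _ : Fin q => (Finset.univ : Finset (Option W)))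
    (fun j o => prob (fun w => t (j, w)) o)
  rw [Fintype.piFinset_univ] at this
  unfold wt
  rw [← this]
  simp only [prob_sum, Finset.prod_const_one]

lemma wt_marginal {W : Type*} [Fintype W] {q : ℕ} (t : Fin q × W → unitInterval) (j : Fin q)
    (w : W) : ∑ s, wt t s * (if s j = some w then 1 else 0) = (t (j, w) : ℝ) / Fintype.card W := by
  have := Finset.prod_univ_sum (fun _ : Fin q => (Finset.univ : Finset (Option W)))
    (fun i o => prob (fun w => t (i, w)) o *
      (if i = j then (if o = some w then 1 else 0) else 1))
  rw [Fintype.piFinset_univ] at this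
  simp only [Finset.prod_mul_distrib, Finset.prod_ite_eq', Finset.mem_univ, if_true] at this
  unfold wt
  rw [← this]
  rw [Finset.prod_eq_single j]
  · simp [prob]
  · intro i _ hi
    simp only [hi, if_false, mul_one, prob_sum]
  · simp

lemma wt_continuous {W : Type*} [Fintype W] {q : ℕ} (s : Fin q → Option W) :
    Continuous (fun t : Fin q × W → unitInterval => wt t s) := by
  unfold wt
  apply continuous_finsetProd
  intro j _
  cases s j with
  | none => simp only [prob]; fun_prop
  | some w => simp only [prob]; fun_prop

/-- The measure attached to a point of the cube. -/
noncomputable def meas {W : Type*} [Fintype W] {q : ℕ} (pts : (Fin q → Option W) → X)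
    (t : Fin q × W → unitInterval) : ProbabilityMeasure X :=
  ⟨∑ s, ENNReal.ofReal (wt t s) • Measure.dirac (pts s), ⟨by
    simp only [Measure.coe_finsetSum, Finset.sum_apply, Measure.smul_apply, measure_univ,
      smul_eq_mul, mul_one]
    rw [← ENNReal.ofReal_sum_of_nonneg (fun s _ => wt_nonneg t s), wt_sum, ENNReal.ofReal_one]⟩⟩

lemma integral_meas {W : Type*} [Fintype W] {q : ℕ} (pts : (Fin q → Option W) → X)
    (t : Fin q × W → unitInterval) (f : C(X, ℝ)) :
    ∫ x, f x ∂(meas pts t : Measure X) = ∑ s, wt t s * f (pts s) := by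
  change ∫ x, f x ∂(∑ s, ENNReal.ofReal (wt t s) • Measure.dirac (pts s)) = _
  rw [integral_finsetSum_measure]
  · apply Finset.sum_congr rfl
    intro s _
    rw [integral_smul_measure, integral_dirac, ENNReal.toReal_ofReal (wt_nonneg t s), smul_eq_mul]
  · intro s _
    exact (integrable_cont f _).smul_measure ENNReal.ofReal_ne_top

lemma meas_continuous {W : Type*} [Fintype W] {q : ℕ} (pts : (Fin q → Option W) → X) :
    Continuous (meas pts) := by
  rw [ProbabilityMeasure.continuous_iff_forall_continuousMap_continuous_integral]
  intro f
  simp only [integral_meas]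
  apply continuous_finsetSum
  intro s _
  exact (wt_continuous s).mul continuous_const

/-- Basic open sets. -/
def half {W : Type*} [Fintype W] (f : W → C(X, ℝ)) (w : W) (b : Bool) :
    Set (ProbabilityMeasure X) :=
  {μ | if b then ∫ x, f w x ∂(μ : Measure X) < 1 / Fintype.card W
    else 0 < ∫ x, f w x ∂(μ : Measure X)}

/-- The cover. -/
noncomputable def cov {W : Type*} [Fintype W] (f : W → C(X, ℝ)) :
    Finset (Set (ProbabilityMeasure X)) :=
  Finset.univ.image (fun b : W → Bool => ⋂ w, half f w (b w))

lemma half_open {W : Type*} [Fintype W] (f : W → C(X, ℝ)) (w : W) (b : Bool) :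
    IsOpen (half f w b) := by
  have := ProbabilityMeasure.continuous_integral_continuousMap (X := X) (f w)
  cases b
  · simpa [half] using isOpen_lt continuous_const this
  · simpa [half] using isOpen_lt this continuous_const

lemma cov_cover {W : Type*} [Fintype W] [Nonempty W] (f : W → C(X, ℝ)) :
    IsFinOpenCover (cov f) := by
  constructor
  · intro U hU
    obtain ⟨b, _, rfl⟩ := Finset.mem_image.1 hU
    exact isOpen_iInter_of_finite fun w => half_open f w _
  · intro μ
    have : ∀ w, ∃ b, μ ∈ half f w b := by
      intro w
      by_cases h : 0 < ∫ x, f w x ∂(μ : Measure X)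
      · exact ⟨false, by simpa [half] using h⟩
      · refine ⟨true, ?_⟩
        have h2 : (0 : ℝ) < 1 / Fintype.card W := by
          have : 0 < Fintype.card W := Fintype.card_pos
          positivity
        simp only [half, Set.mem_ofPred_eq, if_true]
        linarith
    choose b hb using this
    exact ⟨_, Finset.mem_image.2 ⟨b, Finset.mem_univ _, rfl⟩, Set.mem_iInter.2 hb⟩

lemma dynJoin_cover {Y : Type*} [TopologicalSpace Y] {S : Y → Y} (hS : Continuous S) (n : ℕ)
    {α : Finset (Set Y)} (hα : IsFinOpenCover α) : IsFinOpenCover (dynJoin S n α) := by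
  constructor
  · intro U hU
    obtain ⟨g, hg, rfl⟩ := Finset.mem_image.1 hU
    rw [Fintype.mem_piFinset] at hg
    exact isOpen_iInter_of_finite fun i => (hα.1 _ (hg i)).preimage (hS.iterate _)
  · intro y
    choose U hU hy using fun i : Fin n => hα.2 (S^[(i : ℕ)] y)
    exact ⟨_, Finset.mem_image.2 ⟨U, Fintype.mem_piFinset.2 hU, rfl⟩, Set.mem_iInter.2 hy⟩

lemma main_bound (T : X → X) (hT : Continuous T) {W : Type*} [Fintype W] [Nonempty W]
    (f : W → C(X, ℝ)) (K q : ℕ) (hK : 1 ≤ K) (pts : (Fin q → Option W) → X)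
    (hpts : ∀ s (j : Fin q) w, f w (T^[K * j] (pts s)) = if s j = some w then 1 else 0) :
    q * Fintype.card W ≤ coverD (dynJoin (ind T hT) (K * q) (cov f)) := by
  have hIntegral : ∀ t (j : Fin q) w,
      ∫ x, f w x ∂((ind T hT)^[K * j] (meas pts t) : Measure X) =
        (t (j, w) : ℝ) / Fintype.card W := by
    intro t j w
    rw [integral_ind]
    have := integral_meas pts t ((f w).comp ⟨T^[K * j], hT.iterate _⟩)
    simp only [ContinuousMap.comp_apply, ContinuousMap.coe_mk, hpts] at this
    rw [this, wt_marginal]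
  unfold coverD
  apply le_csInf
  · exact ⟨_, _, dynJoin_cover (ind_continuous T hT) _ (cov_cover f),
      fun V hV => ⟨V, hV, subset_rfl⟩, rfl⟩
  rintro c ⟨β, hβ, href, rfl⟩
  obtain ⟨p, hp⟩ := lebesgue' (ι := Fin q × W) β (fun U => meas pts ⁻¹' U)
    (fun U hU => (hβ.1 U hU).preimage (meas_continuous pts)) (fun p => hβ.2 _) (by
      rintro U hU ⟨j, w⟩
      obtain ⟨A, hA, hUA⟩ := href U hU
      obtain ⟨g, hg, rfl⟩ := Finset.mem_image.1 hA
      rw [Fintype.mem_piFinset] at hg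
      have hlt : K * j < K * q := Nat.mul_lt_mul_of_pos_left j.2 hK
      obtain ⟨b, _, hb⟩ := Finset.mem_image.1 (hg ⟨K * j, hlt⟩)
      have hmem : ∀ t, t ∈ meas pts ⁻¹' U → (ind T hT)^[K * j] (meas pts t) ∈ half f w (b w) := by
        intro t ht
        have h1 := Set.mem_iInter.1 (hUA ht) ⟨K * j, hlt⟩
        rw [← hb] at h1
        exact Set.mem_iInter.1 h1 w
      cases hbw : b w with
      | true =>
        right
        intro t ht h1
        have := hmem t ht
        rw [hbw] at this
        simp only [half, Set.mem_ofPred_eq, if_true] at this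
        rw [hIntegral, h1] at this
        simp at this
      | false =>
        left
        intro t ht h1
        have := hmem t ht
        rw [hbw] at this
        simp only [half, Set.mem_ofPred_eq] at this
        rw [hIntegral, h1] at this
        simp at this)
  unfold coverOrd
  have hle : (β.filter (fun U => meas pts p ∈ U)).card ≤
      sSup {c : ℕ | ∃ y : ProbabilityMeasure X, (β.filter (fun U => y ∈ U)).card = c} := by
    apply le_csSup
    · refine ⟨β.card, ?_⟩
      rintro c ⟨y, rfl⟩
      exact Finset.card_filter_le _ _
    · exact ⟨_, rfl⟩
  have hcard : Fintype.card (Fin q × W) = q * Fintype.card W := by simp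
  have hp' : Fintype.card (Fin q × W) + 1 ≤ (β.filter (fun U => meas pts p ∈ U)).card := hp
  omega

/-- Coding blocks of length `L+1`. -/
def enc (L : ℕ) {q : ℕ} (s : Fin q → Option (Fin L → Bool)) (i : ℕ) : Bool :=
  if h : i / (L + 1) < q then
    match s ⟨i / (L + 1), h⟩ with
    | none => false
    | some w => if h : i % (L + 1) - 1 < L ∧ i % (L + 1) ≠ 0 then w ⟨i % (L + 1) - 1, h.1⟩ else true
  else false

/-- Cylinder sets. -/
def cyl (L : ℕ) (w : Fin L → Bool) : Set (ℕ → Bool) :=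
  {y | y 0 = true ∧ ∀ i : Fin L, y (i + 1) = w i}

lemma cyl_clopen (L : ℕ) (w : Fin L → Bool) : IsClopen (cyl L w) := by
  have : cyl L w = (fun y : ℕ → Bool => y 0) ⁻¹' {true} ∩
      ⋂ i : Fin L, (fun y : ℕ → Bool => y (i + 1)) ⁻¹' {w i} := by
    ext y; simp [cyl]
  rw [this]
  refine IsClopen.inter ((isClopen_discrete _).preimage (by fun_prop)) ?_
  exact isClopen_iInter_of_finite fun i => (isClopen_discrete _).preimage (by fun_prop)

lemma enc_mem (L : ℕ) {q : ℕ} (s : Fin q → Option (Fin L → Bool)) (j : Fin q) (w : Fin L → Bool) :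
    (fun i => enc L s (i + (L + 1) * j)) ∈ cyl L w ↔ s j = some w := by
  have hdiv : ∀ r, r < L + 1 → (r + (L + 1) * j) / (L + 1) = j := by
    intro r hr
    rw [Nat.add_mul_div_left _ _ (Nat.succ_pos L), Nat.div_eq_of_lt hr, zero_add]
  have hmod : ∀ r, r < L + 1 → (r + (L + 1) * j) % (L + 1) = r := by
    intro r hr
    rw [Nat.add_mul_mod_self_left, Nat.mod_eq_of_lt hr]
  have henc : ∀ r, r < L + 1 → enc L s (r + (L + 1) * j) =
      match s j with
      | none => false
      | some w => if h : r - 1 < L ∧ r ≠ 0 then w ⟨r - 1, h.1⟩ else true := by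
    intro r hr
    unfold enc
    simp only [hdiv r hr, hmod r hr, j.2, dif_pos]
  have h0 := henc 0 (by omega)
  have h1 : ∀ i : Fin L, _ := fun i => henc (i + 1) (by omega)
  simp only [cyl, Set.mem_ofPred_eq]
  rw [h0]
  simp only [h1]
  cases hs : s j with
  | none => simp
  | some v => simp [funext_iff]

lemma shift_iter {X : Type*} (T : X → X) (k : ℕ) (φ : (ℕ → Bool) → X)
    (h : ∀ y : ℕ → Bool, φ (fun i => y (i + 1)) = T^[k] (φ y)) (n : ℕ) : ∀ y : ℕ → Bool,
    φ (fun i => y (i + n)) = T^[k * n] (φ y) := by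
  induction n with
  | zero => intro y; rfl
  | succ n ih =>
    intro y
    have := ih (fun i => y (i + 1))
    rw [h, ← Function.iterate_add_apply] at this
    rw [Nat.mul_succ, ← this]
    congr 1

lemma meanDim_ge (T : X → X) (hT : Continuous T) (k : ℕ) (hk : 1 ≤ k) (φ : (ℕ → Bool) → X)
    (hφ : Continuous φ) (hinj : Function.Injective φ)
    (h : ∀ y : ℕ → Bool, φ (fun i => y (i + 1)) = T^[k] (φ y)) (L : ℕ) :
    ((2 ^ L : ℕ) : ENNReal) / ((k * (L + 1) : ℕ) : ENNReal) ≤ meanDim (ind T hT) := by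
  have hf : ∀ w : Fin L → Bool, ∃ f : C(X, ℝ), ∀ y, f (φ y) = if y ∈ cyl L w then 1 else 0 := by
    intro w
    obtain ⟨f, hf0, hf1, _⟩ := exists_continuous_zero_one_of_isClosed
      (s := φ '' (cyl L w)ᶜ) (t := φ '' cyl L w)
      ((cyl_clopen L w).compl.1.isCompact.image hφ).isClosed
      ((cyl_clopen L w).1.isCompact.image hφ).isClosed
      ((Set.disjoint_image_iff hinj).2 disjoint_compl_left)
    refine ⟨f, fun y => ?_⟩
    split_ifs with hy
    · exact hf1 (Set.mem_image_of_mem φ hy)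
    · exact hf0 (Set.mem_image_of_mem φ hy)
  choose f hf using hf
  set K := k * (L + 1) with hKdef
  have hK : 1 ≤ K := Nat.mul_pos hk (Nat.succ_pos L)
  have hb : ∀ q, q * 2 ^ L ≤ coverD (dynJoin (ind T hT) (K * q) (cov f)) := by
    intro q
    have := main_bound T hT f K q hK (fun s => φ (enc L s)) (by
      intro s j w
      rw [hKdef, mul_assoc, ← shift_iter T k φ h, hf]
      simp only [enc_mem]
      congr)
    simpa using this
  unfold meanDim
  refine le_trans ?_ (le_iSup₂ (cov f) (cov_cover f))
  apply Filter.le_limsup_of_frequently_le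
  · rw [Filter.frequently_atTop]
    intro a
    refine ⟨K * (a + 1), by nlinarith, ?_⟩
    have h1 : (((a + 1) * 2 ^ L : ℕ) : ENNReal) ≤
        (coverD (dynJoin (ind T hT) (K * (a + 1)) (cov f)) : ENNReal) := by
      exact_mod_cast hb (a + 1)
    refine le_trans ?_ (ENNReal.div_le_div_right h1 _)
    rw [Nat.mul_comm K, Nat.cast_mul (a + 1) K, Nat.cast_mul (a + 1)]
    rw [ENNReal.mul_div_mul_left _ _ (by simp) (ENNReal.natCast_ne_top _)]
  · isBoundedDefault

end

end Horse

/-- If `(X,T)` has a horseshoe — i.e. the full shift on `{0,1}^ℕ` embeds in some power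
`(X, T^k)` — then the induced system on probability measures has infinite mean dimension. -/
theorem meanDim_induced_infinite_of_horseshoe {X : Type*} [MetricSpace X] [CompactSpace X]
    [MeasurableSpace X] [BorelSpace X] (T : X → X) (hT : Continuous T)
    (hhorse : ∃ (k : ℕ), 1 ≤ k ∧ ∃ φ : (ℕ → Bool) → X,
      Continuous φ ∧ Function.Injective φ ∧
      ∀ y : ℕ → Bool, φ (fun i => y (i + 1)) = T^[k] (φ y)) :
    meanDim (fun μ : ProbabilityMeasure X => μ.map (f := T) hT.measurable.aemeasurable)
      = ⊤ := by
  obtain ⟨k, hk, φ, hφ, hinj, h⟩ := hhorse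
  change meanDim (Horse.ind T hT) = ⊤
  apply ENNReal.eq_top_of_forall_nnreal_le
  intro r
  obtain ⟨a, ha⟩ := exists_nat_ge r
  have h1 := Horse.meanDim_ge T hT k hk φ hφ hinj h (2 * (a * k) + 1)
  refine le_trans ?_ h1
  have ha' : (r : ENNReal) ≤ (a : ENNReal) := by exact_mod_cast ha
  refine le_trans ha' ?_
  have hpos : k * (2 * (a * k) + 1 + 1) ≠ 0 := by positivity
  rw [ENNReal.le_div_iff_mul_le (Or.inl (by exact_mod_cast hpos))
    (Or.inl (ENNReal.natCast_ne_top _))]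
  norm_cast
  have h2 : a * k < 2 ^ (a * k) := Nat.lt_two_pow_self
  have h3 : 2 ^ (2 * (a * k) + 1) = 2 * (2 ^ (a * k) * 2 ^ (a * k)) := by
    rw [pow_succ, two_mul, pow_add]; ring
  have h4 : (a * k + 1) * (a * k + 1) ≤ 2 ^ (a * k) * 2 ^ (a * k) := Nat.mul_le_mul h2 h2
  have h5 : a * (k * (2 * (a * k) + 1 + 1)) = 2 * (a * k * (a * k + 1)) := by ring
  have h6 : a * k * (a * k + 1) ≤ (a * k + 1) * (a * k + 1) :=
    Nat.mul_le_mul_right _ (Nat.le_succ _)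
  rw [h3, h5]
  omega
end

section
/- Let (X,d) be a compact metric space, T: X → X continuous, and suppose the upper Minkowski dimension of (X,d) is finite. Then for every α > overline-dim_M(X,d) there is C > 0 such that for all 0 < ε < 1, h_W(T_*, ε) ≤ C ε^{-α}. In particular, if dim_M(X,d) = 0 then lim_{ε→0} log h_W(T_*,ε)/log(1/ε) = 0. -/
open MeasureTheory Filter

/-- The 1-Wasserstein distance (Kantorovich–Rubinstein dual form). -/
noncomputable def wasserstein {X : Type*} [MetricSpace X] [MeasurableSpace X]
    (μ ν : ProbabilityMeasure X) : ℝ :=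
  sSup {r : ℝ | ∃ f : X → ℝ, LipschitzWith 1 f ∧
    r = ∫ x, f x ∂(μ : Measure X) - ∫ x, f x ∂(ν : Measure X)}

variable {X : Type*} [MetricSpace X] [CompactSpace X] [MeasurableSpace X] [BorelSpace X]

/-- Minimal cardinality of an `ε`-covering of `X`. -/
noncomputable def covNum (X : Type*) [MetricSpace X] (ε : ℝ) : ℕ :=
  sInf {c : ℕ | ∃ F : Finset X, F.card = c ∧ ∀ x : X, ∃ p ∈ F, dist x p ≤ ε}

/-- Upper Minkowski dimension of `(X,d)`. -/
noncomputable def upperMinkowskiDim (X : Type*) [MetricSpace X] : ℝ :=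
  Filter.limsup (fun ε : ℝ => Real.log (covNum X ε) / Real.log (1 / ε))
    (nhdsWithin 0 (Set.Ioi 0))

/-- Maximal cardinality of an `(n,ε)`-separated set of probability measures for the
dynamical Wasserstein metric of the induced system `T_*`. -/
noncomputable def sepNumW (T : X → X) (hT : Continuous T) (n : ℕ) (ε : ℝ) : ℕ :=
  sSup {c : ℕ | ∃ E : Finset (ProbabilityMeasure X), E.card = c ∧
    ∀ μ ∈ E, ∀ ν ∈ E, μ ≠ ν → ∃ i < n,
      ε < wasserstein (μ.map (f := T^[i]) (hT.iterate i).measurable.aemeasurable)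
            (ν.map (f := T^[i]) (hT.iterate i).measurable.aemeasurable)}

/-- `h_W(T_*, ε)`. -/
noncomputable def entW (T : X → X) (hT : Continuous T) (ε : ℝ) : ℝ :=
  Filter.limsup (fun n : ℕ => Real.log (sepNumW T hT n ε) / n) Filter.atTop


lemma exists_nearest (F : Finset X) (hF : F.Nonempty) :
    ∃ π : X → X, Measurable π ∧ ∀ x, π x ∈ F ∧ ∀ p ∈ F, dist x (π x) ≤ dist x p := by
  classical
  induction hF using Finset.Nonempty.cons_induction with
  | singleton a => exact ⟨fun _ => a, measurable_const, fun x => by simp⟩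
  | cons a s ha hs ih =>
    obtain ⟨π, hm, hπ⟩ := ih
    refine ⟨fun x => if dist x a ≤ dist x (π x) then a else π x, ?_, ?_⟩
    · refine Measurable.ite ?_ measurable_const hm
      exact measurableSet_le (by fun_prop) (measurable_id.dist hm)
    · intro x
      by_cases h : dist x a ≤ dist x (π x)
      · simp only [h, if_true, Finset.mem_cons, true_or, true_and]
        rintro p (rfl | hp)
        · exact le_rfl
        · exact h.trans ((hπ x).2 p hp)
      · simp only [h, if_false, Finset.mem_cons, (hπ x).1, or_true, true_and]
        rintro p (rfl | hp)
        · exact (not_le.mp h).le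
        · exact (hπ x).2 p hp

lemma integral_comp_fin (F : Finset X) (π : X → X) (hm : Measurable π) (hπ : ∀ x, π x ∈ F)
    (μ : ProbabilityMeasure X) (g : X → ℝ) :
    ∫ x, g (π x) ∂(μ : Measure X) = ∑ p ∈ F, (μ : Measure X).real (π ⁻¹' {p}) * g p := by
  classical
  have h : ∀ x, g (π x) = ∑ p ∈ F, (π ⁻¹' {p}).indicator (fun _ => g p) x := by
    intro x
    rw [Finset.sum_eq_single (π x)]
    · simp
    · intro b _ hb
      simp [Set.indicator, hb.symm]
    · intro h; exact absurd (hπ x) h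
  have hs : ∀ p : X, MeasurableSet (π ⁻¹' {p}) := fun p => hm (measurableSet_singleton p)
  simp_rw [h]
  rw [integral_finsetSum]
  · refine Finset.sum_congr rfl fun p _ => ?_
    rw [integral_indicator_const _ (hs p), smul_eq_mul]
  · intro p _
    exact (integrable_const _).indicator (hs p)

lemma integrable_lip (μ : ProbabilityMeasure X) (f : X → ℝ) (hf : Continuous f) :
    Integrable f (μ : Measure X) :=
  hf.integrable_of_hasCompactSupport (HasCompactSupport.of_compactSpace f)

lemma integral_near (π : X → X) (hm : Measurable π) (δ : ℝ)
    (hπ : ∀ x, dist x (π x) ≤ δ)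
    (μ : ProbabilityMeasure X) (g : X → ℝ) (hg : LipschitzWith 1 g) :
    |∫ x, g x ∂(μ : Measure X) - ∫ x, g (π x) ∂(μ : Measure X)| ≤ δ := by
  have h1 := integrable_lip μ g hg.continuous
  have h2 : Integrable (fun x => g (π x)) (μ : Measure X) := by
    obtain ⟨C, hC⟩ := (isCompact_range hg.continuous).isBounded.exists_norm_le
    exact Integrable.of_bound (hg.continuous.measurable.comp hm).aestronglyMeasurable C
      (Eventually.of_forall fun x => hC _ ⟨_, rfl⟩)
  rw [← integral_sub h1 h2, ← Real.norm_eq_abs]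
  refine (norm_integral_le_of_norm_le_const (C := δ) (Eventually.of_forall fun x => ?_)).trans ?_
  · have := hg.dist_le_mul x (π x)
    rw [← dist_eq_norm]
    simp only [NNReal.coe_one, one_mul] at this
    exact this.trans (hπ x)
  · simp

lemma wass_le (F : Finset X) (π : X → X) (hm : Measurable π) (hF : ∀ x, π x ∈ F) (δ η : ℝ)
    (hδ : 0 ≤ δ) (hη : 0 ≤ η)
    (hπ : ∀ x, dist x (π x) ≤ δ) (μ ν : ProbabilityMeasure X)
    (h : ∀ p ∈ F, |(μ : Measure X).real (π ⁻¹' {p}) - (ν : Measure X).real (π ⁻¹' {p})| ≤ η) :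
    wasserstein μ ν ≤ 2 * δ + F.card * (η * Metric.diam (Set.univ : Set X)) := by
  have hD : 0 ≤ Metric.diam (Set.univ : Set X) := Metric.diam_nonneg
  refine Real.sSup_le ?_ (by positivity)
  rintro r ⟨f, hf, rfl⟩
  have hne : Nonempty X := μ.nonempty
  obtain ⟨x0⟩ := hne
  set g : X → ℝ := fun x => f x - f x0 with hgdef
  have hg : LipschitzWith 1 g := by
    refine LipschitzWith.of_dist_le_mul fun x y => ?_
    have := hf.dist_le_mul x y
    simpa [g, Real.dist_eq] using this
  have hgb : ∀ x, |g x| ≤ Metric.diam (Set.univ : Set X) := by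
    intro x
    have := hf.dist_le_mul x x0
    simp only [NNReal.coe_one, one_mul, Real.dist_eq] at this
    exact this.trans (Metric.dist_le_diam_of_mem isCompact_univ.isBounded trivial trivial)
  have hi : ∀ ρ : ProbabilityMeasure X,
      ∫ x, g x ∂(ρ : Measure X) = ∫ x, f x ∂(ρ : Measure X) - f x0 := by
    intro ρ
    rw [integral_sub (integrable_lip ρ f hf.continuous) (integrable_const _)]
    simp
  have e1 := integral_near π hm δ hπ μ g hg
  have e2 := integral_near π hm δ hπ ν g hg
  rw [integral_comp_fin F π hm hF, hi] at e1 e2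
  have e3 : ∑ p ∈ F, (μ : Measure X).real (π ⁻¹' {p}) * g p
      - ∑ p ∈ F, (ν : Measure X).real (π ⁻¹' {p}) * g p
      ≤ F.card * (η * Metric.diam (Set.univ : Set X)) := by
    rw [← Finset.sum_sub_distrib, ← nsmul_eq_mul]
    refine Finset.sum_le_card_nsmul _ _ _ fun p hp => ?_
    rw [← sub_mul]
    refine (le_abs_self _).trans ?_
    rw [abs_mul]
    exact mul_le_mul (h p hp) (hgb p) (abs_nonneg _) hη
  rw [abs_le] at e1 e2
  linarith [e1.2, e2.1]

lemma floor_close (K : ℕ) (hK : 0 < K) (a b : ℝ) (ha : 0 ≤ a) (hb : 0 ≤ b)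
    (h : ⌊a * K⌋₊ = ⌊b * K⌋₊) : |a - b| ≤ 1 / K := by
  have hK' : (0 : ℝ) < K := by exact_mod_cast hK
  have a1 := Nat.floor_le (mul_nonneg ha hK'.le)
  have a2 := Nat.lt_floor_add_one (a * K)
  have b1 := Nat.floor_le (mul_nonneg hb hK'.le)
  have b2 := Nat.lt_floor_add_one (b * K)
  rw [h] at a1 a2
  rw [abs_le]
  constructor
  · rw [neg_le, neg_sub, le_div_iff₀ hK']; nlinarith
  · rw [le_div_iff₀ hK']; nlinarith

lemma covNum_spec (δ : ℝ) (hδ : 0 < δ) :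
    ∃ F : Finset X, F.card = covNum X δ ∧ ∀ x : X, ∃ p ∈ F, dist x p ≤ δ := by
  refine Nat.sInf_mem (s := {c : ℕ | ∃ F : Finset X, F.card = c ∧ ∀ x : X, ∃ p ∈ F, dist x p ≤ δ}) ?_
  obtain ⟨t, ht, h⟩ := Metric.totallyBounded_iff.mp
    (isCompact_univ (X := X)).totallyBounded δ hδ
  refine ⟨_, ht.toFinset, rfl, fun x => ?_⟩
  obtain ⟨p, hp, hx⟩ := Set.mem_iUnion₂.mp (h (Set.mem_univ x))
  exact ⟨p, by simpa using hp, (Metric.mem_ball.mp hx).le⟩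

/-- The size of the quantization. -/
noncomputable def quantK (X : Type*) [MetricSpace X] (δ : ℝ) : ℕ :=
  ⌈(covNum X δ : ℝ) * Metric.diam (Set.univ : Set X) / δ⌉₊ + 1

lemma sep_card_le (T : X → X) (hT : Continuous T) (n : ℕ) (δ : ℝ) (hδ : 0 < δ)
    (E : Finset (ProbabilityMeasure X))
    (hE : ∀ μ ∈ E, ∀ ν ∈ E, μ ≠ ν → ∃ i < n,
      3 * δ < wasserstein (μ.map (f := T^[i]) (hT.iterate i).measurable.aemeasurable)
            (ν.map (f := T^[i]) (hT.iterate i).measurable.aemeasurable)) :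
    E.card ≤ ((quantK X δ + 1) ^ covNum X δ) ^ n := by
  classical
  rcases E.eq_empty_or_nonempty with rfl | ⟨μ0, hμ0⟩
  · simp
  obtain ⟨x0⟩ : Nonempty X := μ0.nonempty
  obtain ⟨F, hFc, hF⟩ := covNum_spec (X := X) δ hδ
  have hFne : F.Nonempty := by obtain ⟨p, hp, _⟩ := hF x0; exact ⟨p, hp⟩
  obtain ⟨π, hm, hπ⟩ := exists_nearest F hFne
  have hπδ : ∀ x, dist x (π x) ≤ δ := fun x => by
    obtain ⟨p, hp, h⟩ := hF x; exact ((hπ x).2 p hp).trans h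
  set K := quantK X δ with hKdef
  have hK : 0 < K := by simp [hKdef, quantK]
  have hK' : (0 : ℝ) < K := by exact_mod_cast hK
  have hKb : (F.card : ℝ) * ((1 / K) * Metric.diam (Set.univ : Set X)) ≤ δ := by
    have h1 : (covNum X δ : ℝ) * Metric.diam (Set.univ : Set X) / δ ≤ K := by
      rw [hKdef, quantK]; push_cast
      exact (Nat.le_ceil _).trans (by linarith)
    rw [div_le_iff₀ hδ] at h1
    rw [hFc]
    have : (covNum X δ : ℝ) * ((1 / K) * Metric.diam (Set.univ : Set X))
      = (covNum X δ : ℝ) * Metric.diam (Set.univ : Set X) / K := by ring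
    rw [this, div_le_iff₀ hK']; linarith
  let w : ProbabilityMeasure X → X → ℝ := fun ρ p => (ρ : Measure X).real (π ⁻¹' {p})
  have hw0 : ∀ ρ p, 0 ≤ w ρ p := fun ρ p => measureReal_nonneg
  have hw1 : ∀ ρ p, ⌊w ρ p * K⌋₊ < K + 1 := fun ρ p => by
    have : w ρ p ≤ 1 := measureReal_le_one
    refine Nat.lt_succ_of_le (Nat.floor_le_of_le ?_)
    nlinarith
  let P : ℕ → ProbabilityMeasure X → ProbabilityMeasure X := fun i ρ =>
    ρ.map (f := T^[i]) (hT.iterate i).measurable.aemeasurable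
  let Φ : ProbabilityMeasure X → (Fin n → (F → Fin (K + 1))) := fun ρ i p =>
    ⟨⌊w (P i ρ) p * K⌋₊, hw1 _ _⟩
  have hinj : Set.InjOn Φ E := by
    intro μ hμ ν hν hΦ
    by_contra hne
    obtain ⟨i, hi, hlt⟩ := hE μ hμ ν hν hne
    have := wass_le F π hm (fun x => (hπ x).1) δ (1 / K) hδ.le (by positivity) hπδ (P i μ) (P i ν)
      (fun p hp => by
        have h1 := congrFun (congrFun hΦ ⟨i, hi⟩) ⟨p, hp⟩
        exact floor_close K hK _ _ (hw0 _ _) (hw0 _ _) (Fin.mk.inj_iff.mp h1))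
    have h3 : 3 * δ < wasserstein (P i μ) (P i ν) := hlt
    linarith
  have := Finset.card_le_card_of_injOn (s := E) (t := Finset.univ) Φ (fun _ _ => by simp) hinj
  simpa [hFc] using this

/-- The one-step bound. -/
noncomputable def bnd (X : Type*) [MetricSpace X] (δ : ℝ) : ℝ :=
  covNum X δ * Real.log (quantK X δ + 1)

lemma bnd_nonneg (δ : ℝ) : 0 ≤ bnd X δ := by
  refine mul_nonneg (Nat.cast_nonneg _) (Real.log_nonneg ?_)
  have : (0:ℝ) ≤ quantK X δ := Nat.cast_nonneg _
  linarith

lemma sepNumW_bdd (T : X → X) (hT : Continuous T) (n : ℕ) (ε : ℝ) (hε : 0 < ε) :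
    BddAbove {c : ℕ | ∃ E : Finset (ProbabilityMeasure X), E.card = c ∧
    ∀ μ ∈ E, ∀ ν ∈ E, μ ≠ ν → ∃ i < n,
      ε < wasserstein (μ.map (f := T^[i]) (hT.iterate i).measurable.aemeasurable)
            (ν.map (f := T^[i]) (hT.iterate i).measurable.aemeasurable)} := by
  refine ⟨((quantK X (ε / 3) + 1) ^ covNum X (ε / 3)) ^ n, ?_⟩
  rintro c ⟨E, rfl, hE⟩
  refine sep_card_le T hT n (ε / 3) (by positivity) E ?_
  rwa [mul_div_cancel₀ ε (by norm_num : (3:ℝ) ≠ 0)]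

lemma sepNumW_nonempty (T : X → X) (hT : Continuous T) (n : ℕ) (ε : ℝ) :
    {c : ℕ | ∃ E : Finset (ProbabilityMeasure X), E.card = c ∧
    ∀ μ ∈ E, ∀ ν ∈ E, μ ≠ ν → ∃ i < n,
      ε < wasserstein (μ.map (f := T^[i]) (hT.iterate i).measurable.aemeasurable)
            (ν.map (f := T^[i]) (hT.iterate i).measurable.aemeasurable)}.Nonempty :=
  ⟨0, ∅, by simp⟩

lemma sepNumW_le (T : X → X) (hT : Continuous T) (n : ℕ) (ε : ℝ) (hε : 0 < ε) :
    sepNumW T hT n ε ≤ ((quantK X (ε / 3) + 1) ^ covNum X (ε / 3)) ^ n := by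
  refine csSup_le (sepNumW_nonempty T hT n ε) ?_
  rintro c ⟨E, rfl, hE⟩
  refine sep_card_le T hT n (ε / 3) (by positivity) E ?_
  rwa [mul_div_cancel₀ ε (by norm_num : (3:ℝ) ≠ 0)]

lemma sepNumW_anti (T : X → X) (hT : Continuous T) (n : ℕ) (ε ε' : ℝ) (hε : 0 < ε)
    (h : ε ≤ ε') : sepNumW T hT n ε' ≤ sepNumW T hT n ε := by
  refine csSup_le_csSup (sepNumW_bdd T hT n ε hε) (sepNumW_nonempty T hT n ε') ?_
  rintro c ⟨E, hc, hE⟩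
  refine ⟨E, hc, fun μ hμ ν hν hne => ?_⟩
  obtain ⟨i, hi, hlt⟩ := hE μ hμ ν hν hne
  exact ⟨i, hi, h.trans_lt hlt⟩

lemma term_nonneg (T : X → X) (hT : Continuous T) (n : ℕ) (ε : ℝ) :
    0 ≤ Real.log (sepNumW T hT n ε) / n :=
  div_nonneg (Real.log_natCast_nonneg _) (Nat.cast_nonneg _)

lemma term_le (T : X → X) (hT : Continuous T) (n : ℕ) (ε : ℝ) (hε : 0 < ε) :
    Real.log (sepNumW T hT n ε) / n ≤ bnd X (ε / 3) := by
  rcases Nat.eq_zero_or_pos n with rfl | hn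
  · simpa using bnd_nonneg (X := X) (ε / 3)
  have hn' : (0 : ℝ) < n := by exact_mod_cast hn
  rw [div_le_iff₀ hn']
  rcases Nat.eq_zero_or_pos (sepNumW T hT n ε) with h0 | h0
  · rw [h0]
    simpa using mul_nonneg (bnd_nonneg (X := X) (ε / 3)) hn'.le
  have h1 : (sepNumW T hT n ε : ℝ) ≤ (((quantK X (ε / 3) : ℝ) + 1) ^ covNum X (ε / 3)) ^ n := by
    exact_mod_cast sepNumW_le T hT n ε hε
  have h2 := Real.log_le_log (by exact_mod_cast h0) h1
  rw [Real.log_pow, Real.log_pow] at h2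
  rw [bnd]; linarith

lemma term_bdd (T : X → X) (hT : Continuous T) (ε : ℝ) (hε : 0 < ε) :
    IsBoundedUnder (· ≤ ·) atTop (fun n : ℕ => Real.log (sepNumW T hT n ε) / n) :=
  isBoundedUnder_of ⟨_, fun n => term_le T hT n ε hε⟩

lemma term_cobdd (T : X → X) (hT : Continuous T) (ε : ℝ) :
    IsCoboundedUnder (· ≤ ·) atTop (fun n : ℕ => Real.log (sepNumW T hT n ε) / n) :=
  IsBoundedUnder.isCoboundedUnder_le (isBoundedUnder_of ⟨0, fun n => term_nonneg T hT n ε⟩)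

lemma entW_le (T : X → X) (hT : Continuous T) (ε : ℝ) (hε : 0 < ε) :
    entW T hT ε ≤ bnd X (ε / 3) :=
  limsup_le_of_le (term_cobdd T hT ε) (Eventually.of_forall fun n => term_le T hT n ε hε)

lemma entW_nonneg (T : X → X) (hT : Continuous T) (ε : ℝ) (hε : 0 < ε) :
    0 ≤ entW T hT ε :=
  le_limsup_of_frequently_le
    (Frequently.of_forall fun n => term_nonneg T hT n ε) (term_bdd T hT ε hε)

lemma entW_anti (T : X → X) (hT : Continuous T) (ε ε' : ℝ) (hε : 0 < ε)
    (h : ε ≤ ε') : entW T hT ε' ≤ entW T hT ε := by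
  refine limsup_le_limsup (Eventually.of_forall fun n => ?_) (term_cobdd T hT ε')
    (term_bdd T hT ε hε)
  refine div_le_div_of_nonneg_right ?_ (Nat.cast_nonneg _)
  rcases Nat.eq_zero_or_pos (sepNumW T hT n ε') with h0 | h0
  · rw [h0]; simpa using Real.log_natCast_nonneg _
  · exact Real.log_le_log (by exact_mod_cast h0) (by exact_mod_cast sepNumW_anti T hT n ε ε' hε h)

lemma small_lt_one : ∀ᶠ ε in nhdsWithin (0:ℝ) (Set.Ioi 0), 0 < ε ∧ ε < 1 := by
  filter_upwards [Ioo_mem_nhdsGT (zero_lt_one (α := ℝ))] with ε h using h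

lemma dim_nonneg (hfin : ∃ M : ℝ, ∀ᶠ ε in nhdsWithin (0:ℝ) (Set.Ioi 0),
      Real.log (covNum X ε) / Real.log (1 / ε) ≤ M) : 0 ≤ upperMinkowskiDim X := by
  obtain ⟨M, hM⟩ := hfin
  refine le_limsup_of_frequently_le (Eventually.frequently ?_) ⟨M, by simpa using hM⟩
  filter_upwards [small_lt_one] with ε ⟨h0, h1⟩
  refine div_nonneg (Real.log_natCast_nonneg _) (Real.log_nonneg ?_)
  rw [le_div_iff₀ h0]; linarith

lemma cov_le (hfin : ∃ M : ℝ, ∀ᶠ ε in nhdsWithin (0:ℝ) (Set.Ioi 0),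
      Real.log (covNum X ε) / Real.log (1 / ε) ≤ M) (a : ℝ) (ha : upperMinkowskiDim X < a) :
    ∀ᶠ δ in nhdsWithin (0:ℝ) (Set.Ioi 0), (covNum X δ : ℝ) ≤ δ ^ (-a) := by
  obtain ⟨M, hM⟩ := hfin
  have := eventually_lt_of_limsup_lt ha ⟨M, by simpa using hM⟩
  filter_upwards [this, small_lt_one] with δ h ⟨h0, h1⟩
  have hl : 0 < Real.log (1 / δ) := Real.log_pos (by rw [lt_div_iff₀ h0]; linarith)
  rw [div_lt_iff₀ hl] at h
  rcases Nat.eq_zero_or_pos (covNum X δ) with hc | hc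
  · rw [hc]; simpa using Real.rpow_nonneg h0.le _
  · rw [← Real.log_le_log_iff (by exact_mod_cast hc) (Real.rpow_pos_of_pos h0 _),
      Real.log_rpow h0]
    rw [one_div, Real.log_inv] at h
    linarith

lemma bnd_le (δ a α : ℝ) (h0 : 0 < δ) (h1 : δ < 1) (ha : 0 < a) (haα : a < α)
    (hc : (covNum X δ : ℝ) ≤ δ ^ (-a)) :
    bnd X δ ≤ ((Metric.diam (Set.univ : Set X) + 3) ^ ((α - a) / (a + 1)) / ((α - a) / (a + 1)))
      * δ ^ (-α) := by
  set D := Metric.diam (Set.univ : Set X) with hDdef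
  have hD : 0 ≤ D := Metric.diam_nonneg
  set s := (α - a) / (a + 1) with hs
  have hspos : 0 < s := div_pos (by linarith) (by linarith)
  have hpos : 0 < δ ^ (-(a + 1)) := Real.rpow_pos_of_pos h0 _
  have hge1 : 1 ≤ δ ^ (-(a + 1)) :=
    Real.one_le_rpow_of_pos_of_le_one_of_nonpos h0 h1.le (by linarith)
  have hK : (quantK X δ : ℝ) + 1 ≤ (D + 3) * δ ^ (-(a + 1)) := by
    have e0 : 0 ≤ (covNum X δ : ℝ) * D / δ := by positivity
    have e1 := (Nat.ceil_lt_add_one e0).le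
    have e2 : (covNum X δ : ℝ) * D / δ ≤ D * δ ^ (-(a + 1)) := by
      have : δ ^ (-(a + 1)) = δ ^ (-a) / δ := by
        rw [neg_add, ← sub_eq_add_neg, Real.rpow_sub h0, Real.rpow_one]
      rw [this, mul_div_assoc', mul_comm]
      gcongr
    rw [quantK]; push_cast
    linarith
  have hKpos : (0:ℝ) < (quantK X δ : ℝ) + 1 := by positivity
  have hlog : Real.log ((quantK X δ : ℝ) + 1) ≤ (D + 3) ^ s / s * δ ^ (-(α - a)) := by
    refine (Real.log_le_log hKpos hK).trans ?_
    refine (Real.log_le_rpow_div (by positivity) hspos).trans (le_of_eq ?_)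
    rw [Real.mul_rpow (by linarith) hpos.le, ← Real.rpow_mul h0.le]
    have : -(a + 1) * s = -(α - a) := by rw [hs]; field_simp
    rw [this]; ring
  have hl0 : 0 ≤ Real.log ((quantK X δ : ℝ) + 1) :=
    Real.log_nonneg (by have : (0:ℝ) ≤ quantK X δ := Nat.cast_nonneg _
                        linarith)
  calc bnd X δ ≤ δ ^ (-a) * ((D + 3) ^ s / s * δ ^ (-(α - a))) :=
        mul_le_mul hc hlog hl0 (Real.rpow_nonneg h0.le _)
    _ = (D + 3) ^ s / s * (δ ^ (-a) * δ ^ (-(α - a))) := by ring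
    _ = _ := by rw [← Real.rpow_add h0]; congr 2; ring

lemma part_one (T : X → X) (hT : Continuous T)
    (hfin : ∃ M : ℝ, ∀ᶠ ε in nhdsWithin (0:ℝ) (Set.Ioi 0),
      Real.log (covNum X ε) / Real.log (1 / ε) ≤ M) (α : ℝ) (hα : upperMinkowskiDim X < α) :
    ∃ C > (0 : ℝ), ∀ ε : ℝ, 0 < ε → ε < 1 → entW T hT ε ≤ C * ε ^ (-α) := by
  have hd := dim_nonneg hfin
  obtain ⟨a, ha1, ha2⟩ := exists_between hα
  have ha : 0 < a := hd.trans_lt ha1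
  have hα0 : 0 < α := ha.trans ha2
  obtain ⟨δ0, hδ0, hc⟩ := (mem_nhdsGT_iff_exists_Ioo_subset).mp (cov_le hfin a ha1)
  have hδ0 : 0 < δ0 := hδ0
  set B := ((Metric.diam (Set.univ : Set X) + 3) ^ ((α - a) / (a + 1)) / ((α - a) / (a + 1)))
  have hB : 0 < B := by
    have : 0 ≤ Metric.diam (Set.univ : Set X) := Metric.diam_nonneg
    have h2 : 0 < (α - a) / (a + 1) := div_pos (by linarith) (by linarith)
    positivity
  set e := min δ0 1 / 2 with he
  have he0 : 0 < e := by positivity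
  have heδ : e < δ0 := by
    have := min_le_left δ0 1
    have : 0 < min δ0 1 := by positivity
    rw [he]; linarith
  have he1 : e < 1 := by
    have := min_le_right δ0 1
    rw [he]; linarith
  have small : ∀ ε, 0 < ε → ε ≤ e → entW T hT ε ≤ B * (1 / 3) ^ (-α) * ε ^ (-α) := by
    intro ε h0 h1
    refine (entW_le T hT ε h0).trans ?_
    refine (bnd_le (ε / 3) a α (by positivity) (by linarith) ha ha2
      (hc ⟨by positivity, by linarith⟩)).trans (le_of_eq ?_)
    rw [mul_assoc, ← Real.mul_rpow (by norm_num) h0.le]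
    congr 2; ring
  set C0 := B * (1 / 3) ^ (-α)
  have hC0 : 0 < C0 := by positivity
  have hge : ∀ ε : ℝ, 0 < ε → ε < 1 → 1 ≤ ε ^ (-α) := fun ε h0 h1 =>
    Real.one_le_rpow_of_pos_of_le_one_of_nonpos h0 h1.le (by linarith)
  refine ⟨C0 * e ^ (-α), by positivity, fun ε h0 h1 => ?_⟩
  rcases le_total ε e with h | h
  · refine (small ε h0 h).trans ?_
    have := hge e he0 he1
    have h3 : 0 < C0 * ε ^ (-α) := by positivity
    nlinarith
  · refine (entW_anti T hT e ε he0 h).trans ((small e he0 le_rfl).trans ?_)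
    have := hge ε h0 h1
    have h3 : 0 < C0 * e ^ (-α) := by positivity
    nlinarith

lemma log_inv_tendsto : Tendsto (fun ε : ℝ => Real.log (1 / ε))
    (nhdsWithin 0 (Set.Ioi 0)) atTop := by
  simp only [one_div]
  exact Real.tendsto_log_atTop.comp tendsto_inv_nhdsGT_zero

lemma part_two (T : X → X) (hT : Continuous T)
    (h1 : ∀ α : ℝ, 0 < α → ∃ C > (0 : ℝ), ∀ ε : ℝ, 0 < ε → ε < 1 →
      entW T hT ε ≤ C * ε ^ (-α)) :
    Tendsto (fun ε : ℝ => Real.log (entW T hT ε) / Real.log (1 / ε))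
        (nhdsWithin 0 (Set.Ioi 0)) (nhds 0) := by
  by_cases hz : ∀ ε, 0 < ε → entW T hT ε = 0
  · refine tendsto_const_nhds.congr' ?_
    filter_upwards [self_mem_nhdsWithin] with ε hε
    rw [hz ε hε]; simp
  push Not at hz
  obtain ⟨e, he, hne⟩ := hz
  have hep : 0 < entW T hT e := lt_of_le_of_ne (entW_nonneg T hT e he) hne.symm
  have key : ∀ c : ℝ, Tendsto (fun ε : ℝ => c / Real.log (1 / ε))
      (nhdsWithin 0 (Set.Ioi 0)) (nhds 0) := fun c => log_inv_tendsto.const_div_atTop c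
  rw [tendsto_order]
  have hsm : ∀ᶠ ε in nhdsWithin (0:ℝ) (Set.Ioi 0), ε < e := by
    filter_upwards [Ioo_mem_nhdsGT he] with ε h using h.2
  constructor
  · intro b hb
    filter_upwards [(tendsto_order.mp (key (Real.log (entW T hT e)))).1 b hb, hsm, small_lt_one]
      with ε h h2 ⟨h3, h4⟩
    have hl : 0 < Real.log (1 / ε) := Real.log_pos (by rw [lt_div_iff₀ h3]; linarith)
    refine h.trans_le (div_le_div_of_nonneg_right ?_ hl.le)
    exact Real.log_le_log hep (entW_anti T hT ε e h3 h2.le)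
  · intro b hb
    obtain ⟨C, hC, hb2⟩ := h1 (b / 2) (by linarith)
    filter_upwards [(tendsto_order.mp (key (Real.log C))).2 (b / 2) (by linarith), hsm,
      small_lt_one] with ε h h2 ⟨h3, h4⟩
    have hl : 0 < Real.log (1 / ε) := Real.log_pos (by rw [lt_div_iff₀ h3]; linarith)
    have hp : 0 < entW T hT ε := hep.trans_le (entW_anti T hT ε e h3 h2.le)
    have := Real.log_le_log hp (hb2 ε h3 h4)
    rw [Real.log_mul hC.ne' (Real.rpow_pos_of_pos h3 _).ne', Real.log_rpow h3] at this
    rw [div_lt_iff₀ hl] at h ⊢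
    rw [one_div, Real.log_inv] at h ⊢
    linarith

/-- If `X` has finite upper Minkowski dimension then `h_W(T_*,ε) ≤ C ε^{-α}` for every
`α` above that dimension; in particular, if the Minkowski dimension is zero then
`log h_W(T_*,ε) / log(1/ε) → 0`. -/
theorem entW_upper_bound (T : X → X) (hT : Continuous T)
    (hfin : ∃ M : ℝ, ∀ᶠ ε in nhdsWithin (0:ℝ) (Set.Ioi 0),
      Real.log (covNum X ε) / Real.log (1 / ε) ≤ M) :
    (∀ α : ℝ, upperMinkowskiDim X < α → ∃ C > (0 : ℝ), ∀ ε : ℝ, 0 < ε → ε < 1 →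
      entW T hT ε ≤ C * ε ^ (-α)) ∧
    (upperMinkowskiDim X = 0 →
      Filter.Tendsto (fun ε : ℝ => Real.log (entW T hT ε) / Real.log (1 / ε))
        (nhdsWithin 0 (Set.Ioi 0)) (nhds 0)) := by
  refine ⟨fun α hα => part_one T hT hfin α hα, fun h0 => part_two T hT fun α hα => ?_⟩
  exact part_one T hT hfin α (by rw [h0]; exact hα)
end
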